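/- Let $F_1,\dots,F_n$ be independent value distributions with supports contained in pairwise disjoint intervals $[a_i,b_i]$ with $a_1 > b_2$, $a_2 > b_3$, \dots (i.e., the distributions are $0$-ambiguous). Then for every choice of prices $q_1,\dots,q_n \ge 0$ there exists a symmetric, DSIC, ex-post IR digital-goods mechanism whose expected revenue equals $\sum_{i=1}^n q_i\cdot\Pr_{F_i}[v_i \ge q_i]$. In particular, the optimal symmetric mechanism achieves the unconstrained optimal digital-goods revenue $\sum_i \sup_{p>0} p\cdot\Pr_{F_i}[v_i \ge p]$ when distributions have non-overlapping supports. -/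

import Mathlib

open MeasureTheory
open scoped ENNReal

/-- All bids are nonnegative. -/
def NonnegBids {n : ℕ} (v : Fin n → ℝ) : Prop := ∀ i, 0 ≤ v i

/-- Dominant strategy incentive compatibility of a digital-goods mechanism. -/
def IsDSIC {n : ℕ} (A P : (Fin n → ℝ) → Fin n → ℝ) : Prop :=
  ∀ v : Fin n → ℝ, NonnegBids v → ∀ (i : Fin n) (w : ℝ), 0 ≤ w →
    A (Function.update v i w) i * v i - P (Function.update v i w) i ≤
      A v i * v i - P v i

/-- Ex-post individual rationality. -/
def IsExPostIR {n : ℕ} (A P : (Fin n → ℝ) → Fin n → ℝ) : Prop :=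
  ∀ v : Fin n → ℝ, NonnegBids v → ∀ i : Fin n, 0 ≤ A v i * v i - P v i

/-- Anonymity (symmetry): permuting the bids permutes the outcome. -/
def IsAnonymous {n : ℕ} (Q : (Fin n → ℝ) → Fin n → ℝ) : Prop :=
  ∀ (π : Equiv.Perm (Fin n)) (v : Fin n → ℝ), NonnegBids v →
    ∀ i : Fin n, Q (v ∘ π) i = Q v (π i)

/-- Allocations lie in `[0,1]`. -/
def ValidAlloc {n : ℕ} (A : (Fin n → ℝ) → Fin n → ℝ) : Prop :=
  ∀ v : Fin n → ℝ, NonnegBids v → ∀ i : Fin n, 0 ≤ A v i ∧ A v i ≤ 1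

/-- The anonymous price offered to bidder `i`: the sum of those `q k` for which no other
bidder's value lies in `[a k, b k]`. -/
noncomputable def missingPrice {n : ℕ} (a b q : Fin n → ℝ) (v : Fin n → ℝ) (i : Fin n) : ℝ :=
  open Classical in ∑ k, if ∀ j, j ≠ i → v j ∉ Set.Icc (a k) (b k) then q k else 0

/-- The allocation of the mechanism that offers bidder `i` the price `p v i`. -/
noncomputable def postedAlloc {n : ℕ} (p : (Fin n → ℝ) → Fin n → ℝ) (v : Fin n → ℝ)
    (i : Fin n) : ℝ :=
  open Classical in if p v i ≤ v i then 1 else 0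

/-- The payments of the mechanism that offers bidder `i` the price `p v i`. -/
noncomputable def postedPayment {n : ℕ} (p : (Fin n → ℝ) → Fin n → ℝ) (v : Fin n → ℝ)
    (i : Fin n) : ℝ :=
  open Classical in if p v i ≤ v i then p v i else 0

section PostedPrice

variable {n : ℕ} {p : (Fin n → ℝ) → Fin n → ℝ}

lemma measurable_postedAlloc {i : Fin n} (hp : Measurable fun v => p v i) :
    Measurable fun v => postedAlloc p v i :=
  Measurable.ite (measurableSet_le hp (measurable_pi_apply i)) measurable_const measurable_const

lemma measurable_postedPayment {i : Fin n} (hp : Measurable fun v => p v i) :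
    Measurable fun v => postedPayment p v i :=
  Measurable.ite (measurableSet_le hp (measurable_pi_apply i)) hp measurable_const

lemma validAlloc_postedAlloc : ValidAlloc (postedAlloc p) := by
  intro v _ i
  unfold postedAlloc
  split_ifs <;> norm_num

lemma IsAnonymous.postedAlloc (hp : IsAnonymous p) : IsAnonymous (postedAlloc p) := by
  intro π v hv i
  simp only [_root_.postedAlloc, hp π v hv i, Function.comp_apply]

lemma IsAnonymous.postedPayment (hp : IsAnonymous p) : IsAnonymous (postedPayment p) := by
  intro π v hv i
  simp only [_root_.postedPayment, hp π v hv i, Function.comp_apply]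

lemma isExPostIR_posted : IsExPostIR (postedAlloc p) (postedPayment p) := by
  intro v _ i
  unfold postedAlloc postedPayment
  split_ifs <;> linarith

/-- A posted-price mechanism is DSIC if a bidder's price does not depend on their own bid. -/
lemma isDSIC_posted (hp : ∀ v i w, p (Function.update v i w) i = p v i) :
    IsDSIC (postedAlloc p) (postedPayment p) := by
  intro v _ i w _
  simp only [postedAlloc, postedPayment, hp]
  split_ifs <;> linarith

end PostedPrice

section MissingPrice

variable {n : ℕ} {a b q : Fin n → ℝ}

lemma missingPrice_update (v : Fin n → ℝ) (i : Fin n) (w : ℝ) :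
    missingPrice a b q (Function.update v i w) i = missingPrice a b q v i := by
  classical
  unfold missingPrice
  refine Finset.sum_congr rfl fun k _ => if_congr (forall₂_congr fun j hj => ?_) rfl rfl
  rw [Function.update_of_ne hj]

lemma isAnonymous_missingPrice : IsAnonymous (missingPrice a b q) := by
  intro π v _ i
  unfold missingPrice
  refine Finset.sum_congr rfl fun k _ => if_congr ?_ rfl rfl
  rw [← π.forall_congr_right (q := fun j => j ≠ π i → v j ∉ Set.Icc (a k) (b k))]
  simp only [Function.comp_apply, ne_eq, EmbeddingLike.apply_eq_iff_eq]

lemma measurable_missingPrice (i : Fin n) : Measurable fun v => missingPrice a b q v i := by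
  refine Finset.measurable_sum _ fun k _ => Measurable.ite ?_ measurable_const measurable_const
  simp only [Set.ofPred_forall]
  exact MeasurableSet.iInter fun j => MeasurableSet.iInter fun _ =>
    (measurableSet_Icc.preimage (measurable_pi_apply j)).compl

/-- When the intervals are disjoint and every value lies in its own interval, the others' values
reveal the identity of bidder `i`, who is offered `q i`. -/
lemma missingPrice_eq
    (hdisj : Pairwise fun i j => Disjoint (Set.Icc (a i) (b i)) (Set.Icc (a j) (b j)))
    {v : Fin n → ℝ} (hv : ∀ i, v i ∈ Set.Icc (a i) (b i)) (i : Fin n) :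
    missingPrice a b q v i = q i := by
  classical
  unfold missingPrice
  rw [Finset.sum_eq_single i]
  · exact if_pos fun j hj => Set.disjoint_left.1 (hdisj hj) (hv j)
  · exact fun k _ hk => if_neg fun h => h k hk (hv k)
  · simp

end MissingPrice

lemma right_lt_left_of_lt {n : ℕ} {a b : Fin n → ℝ} (hab : ∀ i, a i ≤ b i)
    (hdisj : ∀ (i : Fin n) (h : (i : ℕ) + 1 < n), b ⟨(i : ℕ) + 1, h⟩ < a i)
    {i k : Fin n} (hik : i < k) : b k < a i := by
  obtain ⟨k, hk⟩ := k
  induction k with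
  | zero => exact absurd hik (Nat.not_lt_zero _)
  | succ m ih =>
    have hstep := hdisj ⟨m, by omega⟩ hk
    rcases (Nat.lt_succ_iff.1 hik : (i : ℕ) ≤ m).eq_or_lt with h | h
    · rwa [show i = ⟨m, by omega⟩ from Fin.ext h]
    · exact hstep.trans_le ((hab _).trans (ih (by omega) h).le)

lemma pairwise_disjoint_Icc {n : ℕ} {a b : Fin n → ℝ} (hab : ∀ i, a i ≤ b i)
    (hdisj : ∀ (i : Fin n) (h : (i : ℕ) + 1 < n), b ⟨(i : ℕ) + 1, h⟩ < a i) :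
    Pairwise fun i j => Disjoint (Set.Icc (a i) (b i)) (Set.Icc (a j) (b j)) := by
  intro i j hij
  rw [Set.disjoint_left]
  rintro x ⟨hai, hbi⟩ ⟨haj, hbj⟩
  rcases hij.lt_or_gt with h | h
  · linarith [right_lt_left_of_lt hab hdisj h]
  · linarith [right_lt_left_of_lt hab hdisj h]

lemma le_of_measure_compl_Icc_eq_zero {μ : Measure ℝ} [IsProbabilityMeasure μ] {a b : ℝ}
    (h : μ (Set.Icc a b)ᶜ = 0) : a ≤ b := by
  by_contra hab
  simp [Set.Icc_eq_empty hab] at h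

/-- **Non-overlapping supports: symmetric mechanisms are optimal.**
If the value distributions have supports in pairwise disjoint decreasing intervals
(`a i > b (i+1)` for consecutive indices, i.e. the profile is `0`-ambiguous), then
for every choice of nonnegative posted prices `q` there is a symmetric, DSIC,
ex-post IR digital-goods mechanism whose expected revenue is exactly
`Σ_i q i · Pr[v_i ≥ q i]`. -/
theorem zero_ambiguous_symmetric_optimal
    (n : ℕ) (F : Fin n → Measure ℝ) (a b : Fin n → ℝ)
    (hprob : ∀ i, IsProbabilityMeasure (F i))
    (ha0 : ∀ i, 0 ≤ a i)
    (hsupp : ∀ i, F i (Set.Icc (a i) (b i))ᶜ = 0)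
    (hdisj : ∀ (i : Fin n) (h : (i : ℕ) + 1 < n), b ⟨(i : ℕ) + 1, h⟩ < a i)
    (q : Fin n → ℝ) (hq : ∀ i, 0 ≤ q i) :
    ∃ A P : (Fin n → ℝ) → Fin n → ℝ,
      (∀ i, Measurable fun v => A v i) ∧ (∀ i, Measurable fun v => P v i) ∧
      ValidAlloc A ∧ IsAnonymous A ∧ IsAnonymous P ∧
      IsDSIC A P ∧ IsExPostIR A P ∧
      (∫ v, ∑ i, P v i ∂(Measure.pi F)) =
        ∑ i, q i * ((F i) {x | q i ≤ x}).toReal := by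
  have hab i : a i ≤ b i := le_of_measure_compl_Icc_eq_zero (hsupp i)
  have hpair := pairwise_disjoint_Icc hab hdisj
  refine ⟨postedAlloc (missingPrice a b q), postedPayment (missingPrice a b q),
    fun i => measurable_postedAlloc (measurable_missingPrice i),
    fun i => measurable_postedPayment (measurable_missingPrice i),
    validAlloc_postedAlloc, isAnonymous_missingPrice.postedAlloc,
    isAnonymous_missingPrice.postedPayment, isDSIC_posted missingPrice_update,
    isExPostIR_posted, ?_⟩
  have hmem : ∀ᵐ v ∂Measure.pi F, ∀ i, v i ∈ Set.Icc (a i) (b i) :=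
    ae_all_iff.2 fun i => (Measure.quasiMeasurePreserving_eval (μ := F) i).ae (hsupp i)
  have hS i : MeasurableSet {v : Fin n → ℝ | q i ≤ v i} :=
    measurableSet_le measurable_const (measurable_pi_apply i)
  calc ∫ v, ∑ i, postedPayment (missingPrice a b q) v i ∂Measure.pi F
      = ∫ v, ∑ i, {v : Fin n → ℝ | q i ≤ v i}.indicator (fun _ => q i) v ∂Measure.pi F := by
        refine integral_congr_ae (hmem.mono fun v hv => Finset.sum_congr rfl fun i _ => ?_)
        simp only [postedPayment, missingPrice_eq hpair hv, Set.indicator_apply, Set.mem_ofPred_eq]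
    _ = ∑ i, q i * ((F i) {x | q i ≤ x}).toReal := by
        rw [integral_finsetSum _ fun i _ => (integrable_const _).indicator (hS i)]
        refine Finset.sum_congr rfl fun i _ => ?_
        rw [integral_indicator_const _ (hS i), smul_eq_mul, mul_comm, measureReal_def,
          ← (measurePreserving_eval F i).measure_preimage
            (s := {x | q i ≤ x}) measurableSet_Ici.nullMeasurableSet]
        rfl
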